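/- Let A_1,…,A_m and c be real symmetric n×n matrices, b ∈ ℝ^m, θ ≥ 0, and ε ∈ (0,1). Suppose y* ∈ ℝ^m and ν* ≥ 0 satisfy ∑_{i≤m} y*_i A_i − ν*·I ⪯ c. Let T ∈ ℝ^{d×m} be a matrix satisfying ⟨Tb, Ty*⟩ ≥ bᵀy* − ε‖b‖₂‖y*‖₂ and ‖TᵀT y* − y*‖_∞ ≤ ε‖y*‖₂. Then every real symmetric n×n matrix x with x ⪰ 0, tr(x) ≤ θ, and ∑_{i≤m} T_{ki}·tr(A_i x) = (Tb)_k for all k ≤ d satisfies tr(c·x) ≥ (bᵀy* − θν*) − ε‖y*‖₂(‖Aᵀ‖·θ + ‖b‖₂). In particular, if strong duality holds so that bᵀy* − θν* equals the optimal value v(P) of the original problem, the optimal value of the projected problem is at least v(P) − ε‖y*‖₂(‖Aᵀ‖·θ + ‖b‖₂). -/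

import Mathlib

open MeasureTheory Pointwise

/-- Euclidean (ℓ2) norm of a vector in ℝ^k. -/
noncomputable def norm2 {k : ℕ} (x : Fin k → ℝ) : ℝ := Real.sqrt (∑ i, (x i) ^ 2)

/-- Supremum (ℓ∞) norm of a vector in ℝ^k. -/
noncomputable def normInf {k : ℕ} (x : Fin k → ℝ) : ℝ := ⨆ i, |x i|

/-- Standard Euclidean inner product on ℝ^k. -/
def dotp {k : ℕ} (x y : Fin k → ℝ) : ℝ := ∑ i, x i * y i

/-- ℓ2 operator (spectral) norm of a matrix. -/
noncomputable def specNorm {p q : ℕ} (M : Matrix (Fin p) (Fin q) ℝ) : ℝ :=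
  ⨆ u : {u : Fin q → ℝ // norm2 u ≤ 1}, norm2 (M.mulVec u.1)

/-- ‖Aᵀ‖ := sup { ‖∑ i, y i • A i‖₂ : ‖y‖_∞ ≤ 1 }. -/
noncomputable def ATnorm {n m : ℕ} (A : Fin m → Matrix (Fin n) (Fin n) ℝ) : ℝ :=
  ⨆ y : {y : Fin m → ℝ // normInf y ≤ 1}, specNorm (∑ i, y.1 i • A i)

/-- Smallest eigenvalue of a real symmetric matrix, via the Rayleigh quotient. -/
noncomputable def lambdaMin {n : ℕ} (M : Matrix (Fin n) (Fin n) ℝ) : ℝ :=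
  ⨅ u : {u : Fin n → ℝ // u ≠ 0}, dotp u.1 (M.mulVec u.1) / (∑ i, (u.1 i) ^ 2)

/-- Largest eigenvalue of a real symmetric matrix, via the Rayleigh quotient. -/
noncomputable def lambdaMax {n : ℕ} (M : Matrix (Fin n) (Fin n) ℝ) : ℝ :=
  ⨆ u : {u : Fin n → ℝ // u ≠ 0}, dotp u.1 (M.mulVec u.1) / (∑ i, (u.1 i) ^ 2)

/-- Loewner order: X ⪯ Y iff Y - X is positive semidefinite. -/
def PSDle {n : ℕ} (X Y : Matrix (Fin n) (Fin n) ℝ) : Prop := (Y - X).PosSemidef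

/-- Frobenius norm of a matrix. -/
noncomputable def frobNorm {n : ℕ} (X : Matrix (Fin n) (Fin n) ℝ) : ℝ :=
  Real.sqrt (∑ i, ∑ j, (X i j) ^ 2)

/-- A random matrix `T : Ω → ℝ^{d×m}` is a random projection with constants `c, C` if
for every `ε ∈ (0,1)` and `x ∈ ℝ^m`, `(1-ε)‖x‖² ≤ ‖Tx‖² ≤ (1+ε)‖x‖²` holds with
probability at least `1 - c·exp(-C ε² d)`. -/
def IsRandomProjection {Ω : Type*} [MeasurableSpace Ω] (μ : Measure Ω) {d m : ℕ}
    (T : Ω → Matrix (Fin d) (Fin m) ℝ) (c C : ℝ) : Prop :=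
  ∀ ε ∈ Set.Ioo (0 : ℝ) 1, ∀ x : Fin m → ℝ,
    1 - c * Real.exp (-C * ε ^ 2 * d) ≤
      (μ {ω | (1 - ε) * (norm2 x) ^ 2 ≤ (norm2 ((T ω).mulVec x)) ^ 2 ∧
              (norm2 ((T ω).mulVec x)) ^ 2 ≤ (1 + ε) * (norm2 x) ^ 2}).toReal

/-- Gaussian width of a set `S ⊆ ℝ^k`. -/
noncomputable def gaussWidth {k : ℕ} (S : Set (Fin k → ℝ)) : ℝ :=
  ∫ g, (⨆ x : S, dotp g x.1) ∂(Measure.pi fun _ : Fin k => ProbabilityTheory.gaussianReal 0 1)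

/-- Radius (w.r.t. the Euclidean norm) of a set `S ⊆ ℝ^k`. -/
noncomputable def rad2 {k : ℕ} (S : Set (Fin k → ℝ)) : ℝ := ⨆ x : S, norm2 x.1

/-- Diameter (w.r.t. the Euclidean norm) of a set `S ⊆ ℝ^k`. -/
noncomputable def diam2 {k : ℕ} (S : Set (Fin k → ℝ)) : ℝ :=
  ⨆ p : ↥(S ×ˢ S), norm2 (p.1.1 - p.1.2)

theorem aux_trace {n : ℕ} (M x : Matrix (Fin n) (Fin n) ℝ) (K : ℝ) (hx : x.PosSemidef)
    (h : ∀ v : Fin n → ℝ, dotp v (M.mulVec v) ≤ K * dotp v v) :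
    (M * x).trace ≤ K * x.trace := by
  obtain ⟨B, rfl⟩ : ∃ B : Matrix (Fin n) (Fin n) ℝ, x = B.transpose * B := by
    open scoped MatrixOrder in
    obtain ⟨B, hB⟩ := CStarAlgebra.nonneg_iff_eq_star_mul_self.mp hx.nonneg
    refine ⟨B, ?_⟩
    rw [hB, Matrix.star_eq_conjTranspose, Matrix.conjTranspose_eq_transpose_of_trivial]
  rw [← Matrix.mul_assoc, Matrix.trace_mul_comm, Matrix.trace_mul_comm B.transpose B]
  have h1 : (B * (M * B.transpose)).trace = ∑ k, dotp (B k) (M.mulVec (B k)) := by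
    simp [Matrix.trace, Matrix.mul_apply, dotp, Matrix.mulVec, dotProduct]
  have h2 : (B * B.transpose).trace = ∑ k, dotp (B k) (B k) := by
    simp [Matrix.trace, Matrix.mul_apply, dotp]
  rw [h1, h2, Finset.mul_sum]
  exact Finset.sum_le_sum fun k _ => h (B k)

theorem aux_norm2_sq {k : ℕ} (v : Fin k → ℝ) : norm2 v ^ 2 = dotp v v := by
  unfold norm2 dotp
  rw [Real.sq_sqrt (Finset.sum_nonneg fun i _ => sq_nonneg _)]
  exact Finset.sum_congr rfl fun i _ => sq _

theorem aux_norm2_nonneg {k : ℕ} (v : Fin k → ℝ) : 0 ≤ norm2 v := Real.sqrt_nonneg _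

theorem aux_cs {k : ℕ} (u v : Fin k → ℝ) : dotp u v ≤ norm2 u * norm2 v :=
  Real.sum_mul_le_sqrt_mul_sqrt _ _ _

theorem aux_abs_le {k : ℕ} (v : Fin k → ℝ) (i : Fin k) : |v i| ≤ norm2 v := by
  unfold norm2
  rw [← Real.sqrt_sq_eq_abs]
  exact Real.sqrt_le_sqrt (Finset.single_le_sum (f := fun i => v i ^ 2)
    (fun i _ => sq_nonneg _) (Finset.mem_univ i))

theorem aux_norm2_le {k : ℕ} (v : Fin k → ℝ) : norm2 v ≤ ∑ i, |v i| := by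
  unfold norm2
  apply Real.sqrt_le_iff.mpr
  refine ⟨Finset.sum_nonneg fun i _ => abs_nonneg _, ?_⟩
  have := Finset.sum_sq_le_sq_sum_of_nonneg (s := Finset.univ) (f := fun i => |v i|)
    (fun i _ => abs_nonneg _)
  simpa using this

theorem aux_norm2_smul {k : ℕ} (a : ℝ) (ha : 0 ≤ a) (v : Fin k → ℝ) :
    norm2 (a • v) = a * norm2 v := by
  unfold norm2
  simp only [Pi.smul_apply, smul_eq_mul, mul_pow, ← Finset.mul_sum]
  rw [Real.sqrt_mul (sq_nonneg a), Real.sqrt_sq ha]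

theorem aux_mulVec_bd {p q : ℕ} (M : Matrix (Fin p) (Fin q) ℝ) (u : Fin q → ℝ)
    (hu : norm2 u ≤ 1) : norm2 (M.mulVec u) ≤ ∑ i, ∑ j, |M i j| := by
  refine (aux_norm2_le _).trans (Finset.sum_le_sum fun i _ => ?_)
  have hs : M.mulVec u i = ∑ j, M i j * u j := rfl
  rw [hs]
  refine (Finset.abs_sum_le_sum_abs _ _).trans (Finset.sum_le_sum fun j _ => ?_)
  rw [abs_mul]
  exact mul_le_of_le_one_right (abs_nonneg _) ((aux_abs_le u j).trans hu)

theorem aux_spec_bd {p q : ℕ} (M : Matrix (Fin p) (Fin q) ℝ) :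
    specNorm M ≤ ∑ i, ∑ j, |M i j| :=
  Real.iSup_le (fun u => aux_mulVec_bd M u.1 u.2)
    (Finset.sum_nonneg fun i _ => Finset.sum_nonneg fun j _ => abs_nonneg _)

theorem aux_le_spec {p q : ℕ} (M : Matrix (Fin p) (Fin q) ℝ) (u : Fin q → ℝ)
    (hu : norm2 u ≤ 1) : norm2 (M.mulVec u) ≤ specNorm M :=
  le_ciSup (f := fun u : {u : Fin q → ℝ // norm2 u ≤ 1} => norm2 (M.mulVec u.1))
    ⟨∑ i, ∑ j, |M i j|, by rintro _ ⟨u, rfl⟩; exact aux_mulVec_bd M u.1 u.2⟩ ⟨u, hu⟩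

theorem aux_rayleigh {n : ℕ} (M : Matrix (Fin n) (Fin n) ℝ) (v : Fin n → ℝ) :
    dotp v (M.mulVec v) ≤ specNorm M * dotp v v := by
  refine (aux_cs _ _).trans ?_
  rw [← aux_norm2_sq]
  rcases (aux_norm2_nonneg v).eq_or_lt with h | h
  · simp [← h]
  have h1 := aux_le_spec M ((norm2 v)⁻¹ • v) (by
    rw [aux_norm2_smul _ (inv_nonneg.mpr h.le), inv_mul_cancel₀ h.ne'])
  rw [Matrix.mulVec_smul, aux_norm2_smul _ (inv_nonneg.mpr h.le), inv_mul_le_iff₀ h] at h1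
  nlinarith

theorem aux_abs_le_inf {k : ℕ} (v : Fin k → ℝ) (i : Fin k) : |v i| ≤ normInf v :=
  le_ciSup (f := fun i => |v i|) (Set.finite_range _).bddAbove i

theorem aux_le_AT {n m : ℕ} (A : Fin m → Matrix (Fin n) (Fin n) ℝ) (y : Fin m → ℝ)
    (hy : normInf y ≤ 1) : specNorm (∑ i, y i • A i) ≤ ATnorm A := by
  refine le_ciSup (f := fun y : {y : Fin m → ℝ // normInf y ≤ 1} =>
    specNorm (∑ i, y.1 i • A i)) ⟨∑ i, ∑ j, ∑ k, |A k i j|, ?_⟩ ⟨y, hy⟩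
  rintro _ ⟨y, rfl⟩
  refine (aux_spec_bd _).trans (Finset.sum_le_sum fun i _ => Finset.sum_le_sum fun j _ => ?_)
  rw [Matrix.sum_apply]
  refine (Finset.abs_sum_le_sum_abs _ _).trans (Finset.sum_le_sum fun k _ => ?_)
  rw [Matrix.smul_apply, smul_eq_mul, abs_mul]
  exact mul_le_of_le_one_left (abs_nonneg _) ((aux_abs_le_inf _ k).trans y.2)

theorem aux_AT_nonneg {n m : ℕ} (A : Fin m → Matrix (Fin n) (Fin n) ℝ) : 0 ≤ ATnorm A :=
  Real.iSup_nonneg fun _ => Real.iSup_nonneg fun _ => aux_norm2_nonneg _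

theorem aux_trace_sum {n m : ℕ} (A : Fin m → Matrix (Fin n) (Fin n) ℝ)
    (x : Matrix (Fin n) (Fin n) ℝ) (w : Fin m → ℝ) :
    ((∑ i, w i • A i) * x).trace = ∑ i, w i * (A i * x).trace := by
  simp [Finset.sum_mul, Matrix.trace_sum]

theorem aux_w {n m : ℕ} (A : Fin m → Matrix (Fin n) (Fin n) ℝ)
    (x : Matrix (Fin n) (Fin n) ℝ) (hx : x.PosSemidef) (w : Fin m → ℝ) (r : ℝ) (hr : 0 ≤ r)
    (hw : normInf w ≤ r) :
    ∑ i, w i * (A i * x).trace ≤ r * (ATnorm A * x.trace) := by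
  rcases hr.eq_or_lt with h | h
  · have : ∀ i, w i = 0 := fun i =>
      abs_nonpos_iff.mp (((aux_abs_le_inf w i).trans hw).trans h.symm.le)
    simp [this, ← h]
  have h1 : normInf (r⁻¹ • w) ≤ 1 := by
    refine Real.iSup_le (fun i => ?_) zero_le_one
    rw [Pi.smul_apply, smul_eq_mul, abs_mul, abs_of_pos (inv_pos.mpr h), inv_mul_le_iff₀ h]
    simpa using (aux_abs_le_inf w i).trans hw
  have h2 := aux_trace _ x _ hx (aux_rayleigh (∑ i, (r⁻¹ • w) i • A i))
  rw [aux_trace_sum] at h2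
  have h3 := h2.trans (mul_le_mul_of_nonneg_right (aux_le_AT A _ h1) hx.trace_nonneg)
  simp only [Pi.smul_apply, smul_eq_mul, mul_assoc, ← Finset.mul_sum] at h3
  rwa [inv_mul_le_iff₀ h] at h3

/-- Under the stated conditions on T and dual feasibility of (y*, ν*), every
feasible solution of the projected primal has objective value at least
(bᵀy* − θν*) − ε‖y*‖₂(‖Aᵀ‖θ + ‖b‖₂). -/
theorem stmt_8 {n m d : ℕ} (A : Fin m → Matrix (Fin n) (Fin n) ℝ)
    (hA : ∀ i, (A i).IsSymm) (c : Matrix (Fin n) (Fin n) ℝ) (hc : c.IsSymm)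
    (b : Fin m → ℝ) (θ : ℝ) (hθ : 0 ≤ θ) (ε : ℝ) (hε : ε ∈ Set.Ioo (0 : ℝ) 1)
    (ys : Fin m → ℝ) (νs : ℝ) (hνs : 0 ≤ νs)
    (hdual : PSDle (∑ i, ys i • A i - νs • (1 : Matrix (Fin n) (Fin n) ℝ)) c)
    (T : Matrix (Fin d) (Fin m) ℝ)
    (hT1 : dotp b ys - ε * norm2 b * norm2 ys ≤ dotp (T.mulVec b) (T.mulVec ys))
    (hT2 : normInf (T.transpose.mulVec (T.mulVec ys) - ys) ≤ ε * norm2 ys) :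
    ∀ x : Matrix (Fin n) (Fin n) ℝ, x.PosSemidef → x.trace ≤ θ →
      (∀ k : Fin d, ∑ i, T k i * (A i * x).trace = T.mulVec b k) →
      (dotp b ys - θ * νs) - ε * norm2 ys * (ATnorm A * θ + norm2 b) ≤ (c * x).trace := by
  intro x hx hxt hfeas
  set a : Fin m → ℝ := fun i => (A i * x).trace with ha
  have hTa : T.mulVec a = T.mulVec b := funext fun k => hfeas k
  have hr : 0 ≤ ε * norm2 ys := mul_nonneg hε.1.le (aux_norm2_nonneg _)
  have hw := aux_w A x hx _ _ hr hT2
  have hadj : ∑ i, T.transpose.mulVec (T.mulVec ys) i * a i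
      = dotp (T.mulVec b) (T.mulVec ys) := by
    rw [← hTa]
    change dotProduct (T.transpose.mulVec (T.mulVec ys)) a
      = dotProduct (T.mulVec a) (T.mulVec ys)
    rw [Matrix.mulVec_transpose, ← Matrix.dotProduct_mulVec, dotProduct_comm]
  have hsplit : ∑ i, (T.transpose.mulVec (T.mulVec ys) - ys) i * (A i * x).trace
      = dotp (T.mulVec b) (T.mulVec ys) - ∑ i, ys i * (A i * x).trace := by
    rw [← hadj, ← Finset.sum_sub_distrib]
    exact Finset.sum_congr rfl fun i _ => by simp [ha, sub_mul]
  have hd := aux_trace (-(c - (∑ i, ys i • A i - νs • (1 : Matrix (Fin n) (Fin n) ℝ)))) x 0 hx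
    (fun v => by
      have h := Matrix.PosSemidef.dotProduct_mulVec_nonneg hdual v
      rw [star_trivial] at h
      rw [Matrix.neg_mulVec, zero_mul]
      change dotProduct v (- _) ≤ 0
      rw [dotProduct_neg]
      linarith)
  rw [neg_mul, sub_mul, sub_mul, Matrix.trace_neg, Matrix.trace_sub, Matrix.trace_sub,
    aux_trace_sum, smul_mul_assoc, one_mul, Matrix.trace_smul, smul_eq_mul] at hd
  have h1 : νs * x.trace ≤ νs * θ := mul_le_mul_of_nonneg_left hxt hνs
  have h2 : ε * norm2 ys * (ATnorm A * x.trace) ≤ ε * norm2 ys * (ATnorm A * θ) :=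
    mul_le_mul_of_nonneg_left (mul_le_mul_of_nonneg_left hxt (aux_AT_nonneg A)) hr
  rw [hsplit] at hw
  nlinarith
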